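/- arXiv:1510.04318 — 2 statements merged into one kernel-verified Lean document; each statement's English description precedes it below -/
import Mathlib

section
/- The operator R(x;φ) satisfies the dynamical quantum Yang–Baxter equation in braid-like form: for all x, y ∈ ℂ and φ ∈ ℂ³ that are admissible for this identity, R₁₂(x; φ+κh₃) ∘ R₂₃(x+y; φ−κh₁) ∘ R₁₂(y; φ+κh₃) = R₂₃(y; φ−κh₁) ∘ R₁₂(x+y; φ+κh₃) ∘ R₂₃(x; φ−κh₁) as linear operators on V ⊗ V ⊗ V. -/
noncomputable section

open Complex

/-- `p^w := exp(w · log p)` for a real base `p` and complex exponent `w`. -/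
def pPow (p : ℝ) (w : ℂ) : ℂ := Complex.exp (w * (Real.log p : ℂ))

/-- The renormalised Jacobi theta function
`θ(z;p) = ∏_{m=0}^∞ (1 − p^m z)(1 − p^{m+1}/z)`. -/
def theta (p : ℝ) (z : ℂ) : ℂ :=
  ∏' m : ℕ, ((1 - (p : ℂ) ^ m * z) * (1 - (p : ℂ) ^ (m + 1) / z))

/-- `A^y(x)`. -/
def Afun (p : ℝ) (κ y x : ℂ) : ℂ :=
  (theta p (pPow p (2 * κ)) * theta p (pPow p (y - x)) /
      (theta p (pPow p y) * theta p (pPow p (2 * κ - x)))) *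
    pPow p ((2 * κ - y) * x)

/-- `B^y(x)`. -/
def Bfun (p : ℝ) (κ y x : ℂ) : ℂ :=
  (theta p (pPow p (2 * κ - y)) * theta p (pPow p (-x)) /
      (theta p (pPow p (2 * κ - x)) * theta p (pPow p (-y)))) *
    pPow p (2 * κ * (x - y))

/-- The elliptic `c`-function `c(x) = p^{2κx} θ(p^{2κ+x};p)/θ(p^x;p)`. -/
def cfun (p : ℝ) (κ x : ℂ) : ℂ :=
  pPow p (2 * κ * x) * theta p (pPow p (2 * κ + x)) / theta p (pPow p x)

/-- `(−1)^{p(i)}` for the parity map `p(1)=p(2)=0`, `p(3)=1` (indices `0,1,2` in Lean). -/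
def sgn3 (i : Fin 3) : ℂ := if i = 2 then -1 else 1

/-- The matrix of the elliptic dynamical `R`-operator `R(x;φ)` on `V ⊗ V`, `V = ℂ³`,
with respect to the basis `v_i ⊗ v_j` (the pair `(i,j)` indexes the column, i.e. the input):
`R(x;φ)(v_i ⊗ v_i) = (−1)^{p(i)} (c(x)/c((−1)^{p(i)}x)) v_i ⊗ v_i` and, for `i ≠ j`,
`R(x;φ)(v_i ⊗ v_j) = A^{φ_i−φ_j}(x) v_i ⊗ v_j + (−1)^{p(i)+p(j)} B^{φ_i−φ_j}(x) v_j ⊗ v_i`. -/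
def Rop (p : ℝ) (κ x : ℂ) (φ : Fin 3 → ℂ) :
    Matrix (Fin 3 × Fin 3) (Fin 3 × Fin 3) ℂ := fun ab ij =>
  if ij.1 = ij.2 then
    (if ab = ij then sgn3 ij.1 * (cfun p κ x / cfun p κ (sgn3 ij.1 * x)) else 0)
  else
    (if ab = ij then Afun p κ (φ ij.1 - φ ij.2) x else 0) +
      (if ab = (ij.2, ij.1) then sgn3 ij.1 * sgn3 ij.2 * Bfun p κ (φ ij.1 - φ ij.2) x else 0)

/-- Admissibility of the parameters `(x,φ)` for the operator `R(x;φ)`: every theta-function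
factor occurring in a denominator of an entry of `R(x;φ)` is nonzero. -/
def RAdm (p : ℝ) (κ x : ℂ) (φ : Fin 3 → ℂ) : Prop :=
  theta p (pPow p x) ≠ 0 ∧ theta p (pPow p (2 * κ + x)) ≠ 0 ∧
    theta p (pPow p (2 * κ - x)) ≠ 0 ∧
    ∀ i j : Fin 3, i ≠ j → theta p (pPow p (φ i - φ j)) ≠ 0


/-- The weights of the vector representation `V`:
`wt(1) = (1,0,0)`, `wt(2) = (0,1,0)`, `wt(3) = (0,0,−1)` (indices `0,1,2` in Lean). -/
def wt3 (k : Fin 3) : Fin 3 → ℂ := fun j => if j = k then sgn3 k else 0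

/-- For a family `ψ : Fin 3 → (Fin 3 → ℂ)` of dynamical parameters, the operator on
`V ⊗ V ⊗ V` acting on `v_a ⊗ v_b ⊗ v_c` as `(R(x; ψ c)(v_a ⊗ v_b)) ⊗ v_c`. -/
def R12 (p : ℝ) (κ x : ℂ) (ψ : Fin 3 → Fin 3 → ℂ) :
    Matrix (Fin 3 × Fin 3 × Fin 3) (Fin 3 × Fin 3 × Fin 3) ℂ := fun a b =>
  if a.2.2 = b.2.2 then Rop p κ x (ψ b.2.2) (a.1, a.2.1) (b.1, b.2.1) else 0

/-- For a family `ψ : Fin 3 → (Fin 3 → ℂ)` of dynamical parameters, the operator on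
`V ⊗ V ⊗ V` acting on `v_a ⊗ v_b ⊗ v_c` as `v_a ⊗ (R(x; ψ a)(v_b ⊗ v_c))`. -/
def R23 (p : ℝ) (κ x : ℂ) (ψ : Fin 3 → Fin 3 → ℂ) :
    Matrix (Fin 3 × Fin 3 × Fin 3) (Fin 3 × Fin 3 × Fin 3) ℂ := fun a b =>
  if a.1 = b.1 then Rop p κ x (ψ b.1) (a.2.1, a.2.2) (b.2.1, b.2.2) else 0

/-- An odd function satisfying the three-term (Weierstrass) relation. -/
structure IsThetaLike (s : ℂ → ℂ) : Prop where
  odd : ∀ u, s (-u) = -s u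
  three_term : ∀ a b c d, s (a + b) * s (a - b) * (s (c + d) * s (c - d)) -
    s (a + c) * s (a - c) * (s (b + d) * s (b - d)) +
    s (a + d) * s (a - d) * (s (b + c) * s (b - c)) = 0

/-- The diagonal coefficient of the dynamical `R`-matrix, up to normalisation. -/
def diagCoeff (s : ℂ → ℂ) (η u x : ℂ) : ℂ := s η * s (u - x) / s u

/-- The off-diagonal coefficient of the dynamical `R`-matrix, up to normalisation. -/
def swapCoeff (s : ℂ → ℂ) (η u x : ℂ) : ℂ := s (η - u) * s x / s u

lemma swapCoeff_mul_comm (s : ℂ → ℂ) (η u v x y : ℂ) :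
    swapCoeff s η u x * swapCoeff s η v y = swapCoeff s η u y * swapCoeff s η v x := by
  simp only [swapCoeff]; ring

namespace IsThetaLike

variable {s : ℂ → ℂ}

lemma sub_comm (hs : IsThetaLike s) (a b : ℂ) : s (a - b) = -s (b - a) := by
  rw [← hs.odd, neg_sub]

lemma exchange (hs : IsThetaLike s) (u v x y : ℂ) :
    s (u - y) * s (v - (x + y)) * s x * s (u + v) + s y * s (u + v - (x + y)) * s (u + x) * s v =
      s (v - x) * s (x + y) * s (u + v - y) * s u := by
  have h := hs.three_term ((u + 2 * v - x - y) / 2) ((u + x + y) / 2) ((u - y + x) / 2)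
    ((u - y - x) / 2)
  ring_nf at h ⊢
  linear_combination h

lemma exchange_symm (hs : IsThetaLike s) (u v x y : ℂ) :
    s (u - y) * s (v - (x + y)) * s (u - x) * s v - s (v - x) * s (u - (x + y)) * s (v - y) * s u =
      s (u + v - (x + y)) * s x * s y * s (v - u) := by
  have h := hs.three_term ((u + v - y) / 2) ((u - v - y) / 2) ((u + v - 2 * x - y) / 2)
    ((u - v + y) / 2)
  have e1 := hs.odd y
  have e2 := hs.sub_comm v u
  have e3 := hs.sub_comm x v
  ring_nf at h e1 e2 e3 ⊢
  rw [e1, e3] at h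
  rw [e2]
  linear_combination h

lemma mul_sub_mul (hs : IsThetaLike s) (η u v : ℂ) :
    s (η - u) * s (η + u) * s v ^ 2 - s (η - v) * s (η + v) * s u ^ 2 =
      s η ^ 2 * (s (u + v) * s (v - u)) := by
  have h := hs.three_term η u v 0
  rw [hs.sub_comm u v] at h
  simp only [add_zero, sub_zero] at h
  linear_combination h

lemma diagCoeff_neg (hs : IsThetaLike s) (η u x : ℂ) :
    diagCoeff s η (-u) x = s η * s (u + x) / s u := by
  rw [diagCoeff, ← neg_add', hs.odd, hs.odd]; ring

lemma swapCoeff_neg (hs : IsThetaLike s) (η u x : ℂ) :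
    swapCoeff s η (-u) x = -(s (η + u) * s x / s u) := by
  rw [swapCoeff, hs.odd, sub_neg_eq_add]; ring

variable {u v : ℂ}

/-- Three distinct labels, coefficient of the identity. -/
lemma yb_distinct_id (hs : IsThetaLike s) (hu : s u ≠ 0) (hv : s v ≠ 0) (huv : s (u + v) ≠ 0)
    (η x y : ℂ) :
    diagCoeff s η u x * diagCoeff s η v (x + y) * diagCoeff s η u y +
      swapCoeff s η (-u) x * diagCoeff s η (u + v) (x + y) * swapCoeff s η u y =
    diagCoeff s η v y * diagCoeff s η u (x + y) * diagCoeff s η v x +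
      swapCoeff s η (-v) y * diagCoeff s η (u + v) (x + y) * swapCoeff s η v x := by
  have h1 := hs.exchange_symm u v x y
  have h2 := hs.mul_sub_mul η u v
  rw [hs.swapCoeff_neg, hs.swapCoeff_neg]
  simp only [diagCoeff, swapCoeff]
  field_simp
  linear_combination s η ^ 3 * s (u + v) * h1 - s η * s (u + v - (x + y)) * s x * s y * h2

/-- Three distinct labels, coefficient of a simple transposition. -/
lemma yb_distinct_swap (hs : IsThetaLike s) (hu : s u ≠ 0) (hv : s v ≠ 0) (huv : s (u + v) ≠ 0)
    (η x y : ℂ) :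
    swapCoeff s η u x * diagCoeff s η v (x + y) * diagCoeff s η u y +
      diagCoeff s η (-u) x * diagCoeff s η (u + v) (x + y) * swapCoeff s η u y =
    diagCoeff s η (u + v) y * swapCoeff s η u (x + y) * diagCoeff s η v x := by
  rw [hs.diagCoeff_neg]
  simp only [diagCoeff, swapCoeff]
  field_simp
  linear_combination s (η - u) * s η ^ 2 * hs.exchange u v x y

variable {e η : ℂ}

lemma sign_mul_sub (hs : IsThetaLike s) (he : e = 1 ∨ e = -1) (η x : ℂ) :
    s (e * η - x) = e * s (η - e * x) := by
  rcases he with rfl | rfl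
  · simp
  · rw [show -1 * η - x = -(η - -1 * x) by ring, hs.odd]; ring

lemma sign_mul (hs : IsThetaLike s) (he : e = 1 ∨ e = -1) (η : ℂ) : s (e * η) = e * s η := by
  simpa using hs.sign_mul_sub he η 0

lemma sub_mul_add_of_sign (hs : IsThetaLike s) (he : e = 1 ∨ e = -1) (h : u = v + e * η) :
    s (η - v) * s (η + v) = e * s (η - e * v) * s u := by
  subst h
  rcases he with rfl | rfl
  · simp [add_comm]
  · rw [show v + -1 * η = -(η - v) by ring, hs.odd]; ring_nf

/-- Two equal labels, coefficient of the identity on the vector starting with them. -/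
lemma yb_equal_id (hs : IsThetaLike s) (he : e = 1 ∨ e = -1) (h : u = v + e * η)
    (hu : s u ≠ 0) (hv : s v ≠ 0) (x y : ℂ) :
    s (η - e * x) * diagCoeff s η v (x + y) * s (η - e * y) =
    diagCoeff s η v y * s (η - e * (x + y)) * diagCoeff s η v x +
      swapCoeff s η (-v) y * diagCoeff s η u (x + y) * swapCoeff s η v x := by
  have h1 := hs.exchange_symm v (e * η) x y
  have h2 := hs.sub_mul_add_of_sign he h
  have h3 : e * e = 1 := by rcases he with rfl | rfl <;> ring
  simp only [← h, hs.sign_mul_sub he, hs.sign_mul he] at h1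
  rw [hs.swapCoeff_neg]
  simp only [diagCoeff, swapCoeff]
  generalize s (η - e * x) = dx at *
  generalize s (η - e * y) = dy at *
  generalize s (η - e * (x + y)) = dz at *
  field_simp
  linear_combination s η * (-s u * h1 + s (u - (x + y)) * s x * s y * h2) -
    s η * s u * (dx * dy * s (v - (x + y)) * s v - s η * s (v - y) * dz * s (v - x)) * h3

/-- Two equal labels, coefficient of the transposition moving the second one to the right. -/
lemma yb_equal_swap_right (hs : IsThetaLike s) (he : e = 1 ∨ e = -1) (h : u = v + e * η)
    (hu : s u ≠ 0) (hv : s v ≠ 0) (x y : ℂ) :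
    diagCoeff s η u x * swapCoeff s η v (x + y) * s (η - e * y) =
    swapCoeff s η v y * s (η - e * (x + y)) * diagCoeff s η v x +
      diagCoeff s η (-v) y * diagCoeff s η u (x + y) * swapCoeff s η v x := by
  have h1 := hs.exchange v (e * η) y x
  have h3 : e * e = 1 := by rcases he with rfl | rfl <;> ring
  simp only [← h, hs.sign_mul_sub he, hs.sign_mul he, add_comm y x] at h1
  rw [hs.diagCoeff_neg]
  simp only [diagCoeff, swapCoeff]
  generalize s (η - e * x) = dx at *
  generalize s (η - e * y) = dy at *
  generalize s (η - e * (x + y)) = dz at *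
  field_simp
  linear_combination -s (η - v) * s η * e * h1 -
    s η * s (η - v) * (s (u - x) * s (x + y) * s v * dy - s u * s y * dz * s (v - x) -
      s η * s (v + y) * s (u - (x + y)) * s x) * h3

/-- Two equal labels, coefficient of the transposition moving the second one to the left. -/
lemma yb_equal_swap_left (hs : IsThetaLike s) (he : e = 1 ∨ e = -1) (h : u = v + e * η)
    (hu : s u ≠ 0) (hv : s v ≠ 0) (x y : ℂ) :
    s (η - e * x) * swapCoeff s η (-v) (x + y) * diagCoeff s η u y =
    swapCoeff s η (-v) y * diagCoeff s η u (x + y) * diagCoeff s η (-v) x +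
      diagCoeff s η v y * s (η - e * (x + y)) * swapCoeff s η (-v) x := by
  have h1 := hs.exchange v (e * η) x y
  have h3 : e * e = 1 := by rcases he with rfl | rfl <;> ring
  simp only [← h, hs.sign_mul_sub he, hs.sign_mul he] at h1
  simp only [hs.diagCoeff_neg, hs.swapCoeff_neg]
  simp only [diagCoeff]
  generalize s (η - e * x) = dx at *
  generalize s (η - e * y) = dy at *
  generalize s (η - e * (x + y)) = dz at *
  field_simp
  linear_combination s η * s (η + v) * e * h1 +
    s η * s (η + v) * (s (u - y) * s (x + y) * s v * dx - s u * s (v - y) * dz * s x -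
      s η * s y * s (u - (x + y)) * s (v + x)) * h3

/-- Two equal labels, coefficient of the identity on the vector separating them. -/
lemma yb_equal_mid (hs : IsThetaLike s) (he : e = 1 ∨ e = -1) (h : u = v + e * η)
    (hu : s u ≠ 0) (hv : s v ≠ 0) (x y : ℂ) :
    diagCoeff s η u x * diagCoeff s η (-v) (x + y) * diagCoeff s η u y +
      swapCoeff s η (-u) x * s (η - e * (x + y)) * swapCoeff s η u y =
    diagCoeff s η (-v) y * diagCoeff s η u (x + y) * diagCoeff s η (-v) x +
      swapCoeff s η v y * s (η - e * (x + y)) * swapCoeff s η (-v) x := by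
  have h1 := hs.exchange_symm u (-v) x y
  have h2 := hs.mul_sub_mul η u (-v)
  have h4 : u + -v = e * η := by rw [h]; ring
  simp only [h4, hs.sign_mul_sub he, hs.sign_mul he, ← neg_add', hs.odd, sub_neg_eq_add,
    ← sub_eq_add_neg] at h1 h2
  simp only [hs.diagCoeff_neg, hs.swapCoeff_neg]
  simp only [diagCoeff, swapCoeff]
  generalize s (η - e * x) = dx at *
  generalize s (η - e * y) = dy at *
  generalize s (η - e * (x + y)) = dz at *
  field_simp
  linear_combination s η ^ 3 * h1 - dz * s x * s y * h2

end IsThetaLike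

section PPow

variable (p : ℝ)

lemma pPow_add (v w : ℂ) : pPow p (v + w) = pPow p v * pPow p w := by
  simp only [pPow, add_mul, Complex.exp_add]

lemma pPow_zero : pPow p 0 = 1 := by simp [pPow]

lemma pPow_ne_zero (w : ℂ) : pPow p w ≠ 0 := Complex.exp_ne_zero _

lemma pPow_neg (w : ℂ) : pPow p (-w) = (pPow p w)⁻¹ := by
  simp only [pPow, neg_mul, Complex.exp_neg]

variable {p}

lemma pPow_natCast (hp0 : 0 < p) (n : ℕ) : pPow p n = (p : ℂ) ^ n := by
  rw [pPow, Complex.exp_nat_mul, ← Complex.ofReal_exp, Real.exp_log hp0]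

end PPow

/-- The `n`-th term `(-1)^n p^{(n - 1/2 + u)²/2}` of the theta series. -/
def thetaTerm (p : ℝ) (u : ℂ) (n : ℤ) : ℂ :=
  (-1) ^ n * pPow p ((n - 1 / 2 + u) ^ 2 / 2)

/-- The `q`-Pochhammer symbol `(p; p)_n`. -/
def eulerProd (p : ℝ) (n : ℕ) : ℂ := ∏ i ∈ Finset.range n, (1 + -(p : ℂ) ^ (i + 1))

/-- The reciprocal of `(p; p)_n`, extended by zero to negative `n`. -/
def eulerRecip (p : ℝ) (n : ℤ) : ℂ := if n < 0 then 0 else (eulerProd p n.toNat)⁻¹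

section Finite

variable {p : ℝ}

lemma one_sub_pow_ne_zero (hp0 : 0 < p) (hp1 : p < 1) (i : ℕ) : 1 + -(p : ℂ) ^ (i + 1) ≠ 0 := by
  have h : p ^ (i + 1) < 1 := pow_lt_one₀ hp0.le hp1 (by lia)
  rw [← sub_eq_add_neg, sub_ne_zero]
  exact_mod_cast h.ne'

lemma eulerProd_ne_zero (hp0 : 0 < p) (hp1 : p < 1) (n : ℕ) : eulerProd p n ≠ 0 :=
  Finset.prod_ne_zero_iff.mpr fun i _ ↦ one_sub_pow_ne_zero hp0 hp1 i

lemma eulerProd_succ (hp0 : 0 < p) (n : ℕ) :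
    eulerProd p (n + 1) = eulerProd p n * (1 - pPow p (n + 1)) := by
  rw [eulerProd, Finset.prod_range_succ, ← eulerProd, ← pPow_natCast hp0]
  push_cast
  ring

lemma eulerRecip_sub_one (hp0 : 0 < p) (hp1 : p < 1) (n : ℤ) :
    eulerRecip p (n - 1) = eulerRecip p n * (1 - pPow p n) := by
  obtain hn | rfl | hn := lt_trichotomy n 0
  · simp [eulerRecip, hn, show n < 1 by lia]
  · simp [eulerRecip, pPow_zero]
  · obtain ⟨m, rfl⟩ : ∃ m : ℕ, n = m + 1 := ⟨(n - 1).toNat, by lia⟩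
    have h := eulerProd_ne_zero hp0 hp1 (m + 1)
    have h' := eulerProd_succ hp0 m
    have h1 : ¬ ((m : ℤ) + 1 < 0) := by lia
    have h2 : ((m : ℤ) + 1).toNat = m + 1 := by lia
    rw [h'] at h
    simp only [eulerRecip, add_sub_cancel_right, h1, h2, if_false, Int.toNat_natCast, h']
    obtain ⟨ha, hb⟩ := mul_ne_zero_iff.mp h
    push_cast
    simp only [show ¬ ((m : ℤ) < 0) by lia, if_false]
    field_simp

lemma thetaTerm_shift (u : ℂ) (n : ℤ) (c : ℂ) :
    pPow p (c + u) * thetaTerm p u (n - 1) = -(thetaTerm p u n * pPow p (c + 1 - n)) := by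
  have h : c + u + (((n - 1 : ℤ) : ℂ) - 1 / 2 + u) ^ 2 / 2 =
      ((n : ℂ) - 1 / 2 + u) ^ 2 / 2 + (c + 1 - n) := by push_cast; ring
  rw [thetaTerm, thetaTerm, mul_left_comm, ← pPow_add, h, pPow_add, zpow_sub_one₀ (by norm_num)]
  ring

lemma thetaTerm_shift' (u : ℂ) (n : ℤ) (c : ℂ) :
    pPow p (c - u) * thetaTerm p u (n + 1) = -(thetaTerm p u n * pPow p (c + n)) := by
  have h : c - u + (((n + 1 : ℤ) : ℂ) - 1 / 2 + u) ^ 2 / 2 =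
      ((n : ℂ) - 1 / 2 + u) ^ 2 / 2 + (c + n) := by push_cast; ring
  rw [thetaTerm, thetaTerm, mul_left_comm, ← pPow_add, h, pPow_add, zpow_add_one₀ (by norm_num)]
  ring

lemma hasSum_mul_right_factor (hp0 : 0 < p) (hp1 : p < 1) {u F : ℂ} {a b : ℕ}
    (h : HasSum (fun n : ℤ ↦ eulerProd p (a + b) * eulerRecip p (a + n) * eulerRecip p (b - n) *
      thetaTerm p u n) F) :
    HasSum (fun n : ℤ ↦ eulerProd p (a + (b + 1)) * eulerRecip p (a + n) *
      eulerRecip p ((b + 1 : ℕ) - n) * thetaTerm p u n) ((1 - pPow p (b + u)) * F) := by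
  have h' := ((Equiv.subRight (1 : ℤ)).hasSum_iff.mpr h).mul_left (pPow p (b + u))
  rw [sub_mul, one_mul]
  refine (h.sub h').congr_fun fun n ↦ ?_
  have e1 := eulerRecip_sub_one hp0 hp1 (a + n)
  have e2 := eulerRecip_sub_one hp0 hp1 (b + 1 - n)
  have e3 := thetaTerm_shift (p := p) u n b
  have e4 := pPow_add p (b + 1 - n) (a + n)
  rw [show (b : ℤ) + 1 - n - 1 = b - n by ring] at e2
  rw [show (b + 1 - n + (a + n) : ℂ) = ((a + b : ℕ) : ℂ) + 1 by push_cast; ring] at e4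
  simp only [Function.comp_apply, Equiv.subRight_apply]
  rw [show (a : ℤ) + (n - 1) = a + n - 1 by ring, show (b : ℤ) - (n - 1) = b + 1 - n by ring,
    e1, e2, ← add_assoc, eulerProd_succ hp0, e4]
  push_cast
  linear_combination eulerProd p (a + b) * eulerRecip p (a + n) * (1 - pPow p (a + n)) *
    eulerRecip p (b + 1 - n) * e3

lemma hasSum_mul_left_factor (hp0 : 0 < p) (hp1 : p < 1) {u F : ℂ} {a b : ℕ}
    (h : HasSum (fun n : ℤ ↦ eulerProd p (a + b) * eulerRecip p (a + n) * eulerRecip p (b - n) *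
      thetaTerm p u n) F) :
    HasSum (fun n : ℤ ↦ eulerProd p (a + 1 + b) * eulerRecip p ((a + 1 : ℕ) + n) *
      eulerRecip p (b - n) * thetaTerm p u n) ((1 - pPow p (a + 1 - u)) * F) := by
  have h' := ((Equiv.addRight (1 : ℤ)).hasSum_iff.mpr h).mul_left (pPow p (a + 1 - u))
  rw [sub_mul, one_mul]
  refine (h.sub h').congr_fun fun n ↦ ?_
  have e1 := eulerRecip_sub_one hp0 hp1 (a + 1 + n)
  have e2 := eulerRecip_sub_one hp0 hp1 (b - n)
  have e3 := thetaTerm_shift' (p := p) u n (a + 1)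
  have e4 := pPow_add p (a + 1 + n) (b - n)
  rw [show (a : ℤ) + 1 + n - 1 = a + n by ring] at e1
  rw [show (a + 1 + n + (b - n) : ℂ) = ((a + b : ℕ) : ℂ) + 1 by push_cast; ring] at e4
  simp only [Function.comp_apply, Equiv.coe_addRight]
  rw [show (b : ℤ) - (n + 1) = b - n - 1 by ring, show (a : ℤ) + (n + 1) = a + 1 + n by ring,
    e1, e2, add_right_comm, eulerProd_succ hp0, e4]
  push_cast
  linear_combination eulerProd p (a + b) * eulerRecip p (a + 1 + n) * (1 - pPow p (b - n)) *
    eulerRecip p (b - n) * e3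

/-- The finite form of the Jacobi triple product identity. -/
lemma hasSum_finite_triple_product (hp0 : 0 < p) (hp1 : p < 1) (u : ℂ) (N : ℕ) :
    HasSum (fun n : ℤ ↦ eulerProd p (N + N) * eulerRecip p (N + n) * eulerRecip p (N - n) *
      thetaTerm p u n)
      (pPow p ((u - 1 / 2) ^ 2 / 2) *
        ∏ m ∈ Finset.range N, ((1 - (p : ℂ) ^ m * pPow p u) *
          (1 - (p : ℂ) ^ (m + 1) / pPow p u))) := by
  induction N with
  | zero =>
    convert hasSum_single (0 : ℤ) fun n hn ↦ ?_ using 1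
    · simp [eulerProd, eulerRecip, thetaTerm]
      ring_nf
    · rcases hn.lt_or_gt with h | h <;> simp [eulerRecip, h]
  | succ N ih =>
    convert hasSum_mul_left_factor hp0 hp1 (hasSum_mul_right_factor hp0 hp1 ih) using 1
    rw [Finset.prod_range_succ, pPow_add, pPow_natCast hp0, sub_eq_add_neg (_ : ℂ) u, pPow_add,
      pPow_neg, show (N + 1 : ℂ) = ((N + 1 : ℕ) : ℂ) by push_cast; rfl, pPow_natCast hp0]
    ring

end Finite

section Limit

open Filter Topology

variable {p : ℝ}

lemma summable_norm_pow_succ (hp0 : 0 < p) (hp1 : p < 1) :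
    Summable fun i : ℕ ↦ ‖-(p : ℂ) ^ (i + 1)‖ := by
  simp only [norm_neg, norm_pow, Complex.norm_real, Real.norm_of_nonneg hp0.le]
  exact (summable_nat_add_iff 1).mpr (summable_geometric_of_lt_one hp0.le hp1)

lemma tendsto_eulerProd (hp0 : 0 < p) (hp1 : p < 1) :
    ∃ Q : ℂ, Q ≠ 0 ∧ Tendsto (eulerProd p) atTop (𝓝 Q) :=
  ⟨_, tprod_one_add_ne_zero_of_summable (one_sub_pow_ne_zero hp0 hp1)
      (summable_norm_pow_succ hp0 hp1),
    (multipliable_one_add_of_summable (summable_norm_pow_succ hp0 hp1)).hasProd.tendsto_prod_nat⟩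

lemma tendsto_theta_prod (hp0 : 0 < p) (hp1 : p < 1) (z : ℂ) :
    Tendsto (fun N ↦ ∏ m ∈ Finset.range N, ((1 - (p : ℂ) ^ m * z) * (1 - (p : ℂ) ^ (m + 1) / z)))
      atTop (𝓝 (theta p z)) := by
  have hgeom : Summable fun m : ℕ ↦ p ^ m := summable_geometric_of_lt_one hp0.le hp1
  have h1 : Multipliable fun m : ℕ ↦ 1 + -((p : ℂ) ^ m * z) :=
    multipliable_one_add_of_summable <| by
      simpa [abs_of_pos hp0] using hgeom.mul_right ‖z‖
  have h2 : Multipliable fun m : ℕ ↦ 1 + -((p : ℂ) ^ (m + 1) / z) :=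
    multipliable_one_add_of_summable <| by
      simpa [abs_of_pos hp0] using ((summable_nat_add_iff 1).mpr hgeom).div_const ‖z‖
  have h := (h1.mul h2).hasProd.tendsto_prod_nat
  simpa only [← sub_eq_add_neg, theta] using h

lemma summable_pPow_sq (hp0 : 0 < p) (hp1 : p < 1) {c : ℝ} (hc : 0 < c) (u : ℂ) :
    Summable fun n : ℤ ↦ pPow p (c * (n + u) ^ 2) := by
  have hlog : Real.log p < 0 := Real.log_neg hp0 hp1
  have hpi := Real.pi_pos
  have hpi' : (Real.pi : ℂ) ≠ 0 := by exact_mod_cast hpi.ne'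
  have him : 0 < (-(Complex.I * (c * Real.log p / Real.pi : ℝ))).im := by
    rw [Complex.neg_im, Complex.I_mul_im, Complex.ofReal_re, neg_pos]
    exact div_neg_of_neg_of_pos (mul_neg_of_pos_of_neg hc hlog) hpi
  have h := ((summable_jacobiTheta₂_term_iff
    (-(Complex.I * (c * Real.log p / Real.pi : ℝ)) * u) _).mpr him).mul_left (pPow p (c * u ^ 2))
  refine h.congr fun n ↦ ?_
  rw [jacobiTheta₂_term, pPow, pPow, ← Complex.exp_add]
  congr 1
  push_cast
  field_simp
  linear_combination (-(n * (2 * u + n) * c * Real.log p) : ℂ) * Complex.I_sq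

lemma summable_thetaTerm (hp0 : 0 < p) (hp1 : p < 1) (u : ℂ) : Summable (thetaTerm p u) := by
  have h := (summable_pPow_sq hp0 hp1 (c := 1 / 2) (by norm_num) (u - 1 / 2)).norm
  refine Summable.of_norm (h.congr fun n ↦ ?_)
  rw [thetaTerm, norm_mul, norm_zpow, norm_neg, norm_one, one_zpow, one_mul]
  push_cast
  ring_nf

lemma tendsto_eulerRecip {Q : ℂ} (hQ : Q ≠ 0) (h : Tendsto (eulerProd p) atTop (𝓝 Q))
    {f : ℕ → ℤ} (hf : Tendsto f atTop atTop) :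
    Tendsto (fun N ↦ eulerRecip p (f N)) atTop (𝓝 Q⁻¹) := by
  have h1 : Tendsto (fun N ↦ (f N).toNat) atTop atTop :=
    tendsto_atTop.mpr fun m ↦ (hf.eventually_ge_atTop m).mono fun N hN ↦ by lia
  refine ((h.comp h1).inv₀ hQ).congr' ?_
  filter_upwards [hf.eventually_ge_atTop 0] with N hN
  simp [eulerRecip, not_lt.mpr hN]

lemma exists_norm_eulerRecip_le {Q : ℂ} (hQ : Q ≠ 0) (h : Tendsto (eulerProd p) atTop (𝓝 Q)) :
    ∃ C : ℝ, ∀ n, ‖eulerRecip p n‖ ≤ C := by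
  obtain ⟨C, hC⟩ := (h.inv₀ hQ).norm.bddAbove_range
  have hC' (m : ℕ) : ‖(eulerProd p m)⁻¹‖ ≤ C := hC ⟨m, rfl⟩
  refine ⟨C, fun n ↦ ?_⟩
  by_cases hn : n < 0
  · simpa [eulerRecip, hn] using (norm_nonneg _).trans (hC' 0)
  · simpa [eulerRecip, hn] using hC' n.toNat

/-- The Jacobi triple product identity, up to a multiplicative constant. -/
lemma exists_theta_eq_tsum (hp0 : 0 < p) (hp1 : p < 1) :
    ∃ K : ℂ, ∀ u, pPow p ((u - 1 / 2) ^ 2 / 2) * theta p (pPow p u) =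
      K * ∑' n : ℤ, thetaTerm p u n := by
  obtain ⟨Q, hQ, hlim⟩ := tendsto_eulerProd hp0 hp1
  obtain ⟨C, hC⟩ := exists_norm_eulerRecip_le hQ hlim
  obtain ⟨D, hD⟩ := hlim.norm.bddAbove_range
  have hD' (m : ℕ) : ‖eulerProd p m‖ ≤ D := hD ⟨m, rfl⟩
  have hC0 : 0 ≤ C := (norm_nonneg _).trans (hC 0)
  have hD0 : 0 ≤ D := (norm_nonneg _).trans (hD' 0)
  refine ⟨Q * Q⁻¹ * Q⁻¹, fun u ↦ ?_⟩
  have hdom := tendsto_tsum_of_dominated_convergence (𝓕 := atTop)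
    (f := fun (N : ℕ) (n : ℤ) ↦ eulerProd p (N + N) * eulerRecip p (N + n) *
      eulerRecip p (N - n) * thetaTerm p u n)
    (g := fun n ↦ Q * Q⁻¹ * Q⁻¹ * thetaTerm p u n)
    (bound := fun n ↦ D * C * C * ‖thetaTerm p u n‖)
    ((summable_thetaTerm hp0 hp1 u).norm.mul_left _) (fun n ↦ ?_) (.of_forall fun N n ↦ ?_)
  · rw [tsum_mul_left] at hdom
    refine tendsto_nhds_unique
      (((tendsto_theta_prod hp0 hp1 (pPow p u)).const_mul _).congr fun N ↦ ?_) hdom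
    exact (hasSum_finite_triple_product hp0 hp1 u N).tsum_eq.symm
  · have h2 : Tendsto (fun N : ℕ ↦ N + N) atTop atTop :=
      tendsto_atTop_mono (fun N ↦ Nat.le_add_left N N) tendsto_id
    exact (((hlim.comp h2).mul (tendsto_eulerRecip hQ hlim
      (tendsto_atTop_add_const_right _ n tendsto_natCast_atTop_atTop))).mul
      (tendsto_eulerRecip hQ hlim
        (tendsto_atTop_add_const_right _ (-n) tendsto_natCast_atTop_atTop))).mul_const _
  · simp only [norm_mul]
    gcongr
    exacts [hD' _, hC _, hC _]

lemma tsum_thetaTerm_neg (u : ℂ) : ∑' n, thetaTerm p (-u) n = -∑' n, thetaTerm p u n := by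
  rw [← (Equiv.subLeft (1 : ℤ)).tsum_eq, ← tsum_neg]
  refine tsum_congr fun n ↦ ?_
  rw [Equiv.subLeft_apply, thetaTerm, thetaTerm, zpow_sub₀ (by norm_num)]
  have h : (((1 - n : ℤ) : ℂ) - 1 / 2 + -u) ^ 2 = (n - 1 / 2 + u) ^ 2 := by push_cast; ring
  have h' : ((-1 : ℂ) ^ n)⁻¹ = (-1) ^ n := by rw [← inv_zpow]; norm_num
  rw [h, div_eq_mul_inv, h']
  ring

lemma thetaTerm_mul_even (x y : ℂ) (j k : ℤ) :
    thetaTerm p (x + y) (j + k) * thetaTerm p (x - y) (j - k) =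
      pPow p ((j + (x - 1 / 2)) ^ 2) * pPow p ((k + y) ^ 2) := by
  have h : ((-1 : ℂ) ^ (j + k)) * (-1) ^ (j - k) = 1 := by
    rw [← zpow_add₀ (by norm_num), show j + k + (j - k) = 2 * j by ring, zpow_mul]; simp
  rw [thetaTerm, thetaTerm, mul_mul_mul_comm, h, one_mul, ← pPow_add, ← pPow_add]
  push_cast
  ring_nf

lemma thetaTerm_mul_odd (x y : ℂ) (j k : ℤ) :
    thetaTerm p (x + y) (j + k) * thetaTerm p (x - y) (j - k + 1) =
      -(pPow p ((j + x) ^ 2) * pPow p ((k + (y - 1 / 2)) ^ 2)) := by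
  have h : ((-1 : ℂ) ^ (j + k)) * (-1) ^ (j - k + 1) = -1 := by
    rw [← zpow_add₀ (by norm_num), show j + k + (j - k + 1) = 2 * j + 1 by ring,
      zpow_add₀ (by norm_num), zpow_mul]
    simp
  rw [thetaTerm, thetaTerm, mul_mul_mul_comm, h, neg_one_mul, ← pPow_add, ← pPow_add]
  push_cast
  ring_nf

lemma hasSum_of_parity {F : ℤ × ℤ → ℂ} {a b : ℂ}
    (he : HasSum (fun jk : ℤ × ℤ ↦ F (jk.1 + jk.2, jk.1 - jk.2)) a)
    (ho : HasSum (fun jk : ℤ × ℤ ↦ F (jk.1 + jk.2, jk.1 - jk.2 + 1)) b) :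
    HasSum F (a + b) := by
  have hg : (fun jk : ℤ × ℤ ↦ (jk.1 + jk.2, jk.1 - jk.2)).Injective := fun c d h ↦ by
    simp only [Prod.mk.injEq] at h
    ext <;> lia
  have hg' : (fun jk : ℤ × ℤ ↦ (jk.1 + jk.2, jk.1 - jk.2 + 1)).Injective := fun c d h ↦ by
    simp only [Prod.mk.injEq] at h
    ext <;> lia
  refine (hg.hasSum_range_iff.mpr he).add_isCompl ?_ (hg'.hasSum_range_iff.mpr ho)
  constructor
  · rw [Set.disjoint_left]
    rintro _ ⟨c, rfl⟩ ⟨d, hd⟩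
    simp only [Prod.mk.injEq] at hd
    lia
  · refine codisjoint_iff.mpr (Set.eq_univ_iff_forall.mpr ?_)
    rintro ⟨m, n⟩
    rcases Int.even_or_odd' (m + n) with ⟨j, h | h⟩
    · refine .inl ⟨(j, m - j), ?_⟩
      ext <;> dsimp only <;> lia
    · refine .inr ⟨(j, m - j), ?_⟩
      ext <;> dsimp only <;> lia

lemma hasSum_mul_prod {f g : ℤ → ℂ} (hf : Summable f) (hg : Summable g) :
    HasSum (fun jk : ℤ × ℤ ↦ f jk.1 * g jk.2) ((∑' n, f n) * ∑' n, g n) :=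
  hf.hasSum.mul hg.hasSum (summable_mul_of_summable_norm hf.norm hg.norm)

lemma tsum_thetaTerm_mul (hp0 : 0 < p) (hp1 : p < 1) (x y : ℂ) :
    (∑' n, thetaTerm p (x + y) n) * ∑' n, thetaTerm p (x - y) n =
      (∑' n : ℤ, pPow p ((n + (x - 1 / 2)) ^ 2)) * (∑' n : ℤ, pPow p ((n + y) ^ 2)) -
        (∑' n : ℤ, pPow p ((n + x) ^ 2)) * ∑' n : ℤ, pPow p ((n + (y - 1 / 2)) ^ 2) := by
  have hsum (u : ℂ) : Summable fun n : ℤ ↦ pPow p ((n + u) ^ 2) := by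
    simpa using summable_pPow_sq hp0 hp1 one_pos u
  have hprod (u v : ℂ) := hasSum_mul_prod (hsum u) (hsum v)
  have hall := hasSum_mul_prod (summable_thetaTerm hp0 hp1 (x + y))
    (summable_thetaTerm hp0 hp1 (x - y))
  refine (hall.unique (hasSum_of_parity ?_ ?_)).trans (sub_eq_add_neg _ _).symm
  · exact (hprod (x - 1 / 2) y).congr_fun fun jk ↦ thetaTerm_mul_even x y jk.1 jk.2
  · exact (hprod x (y - 1 / 2)).neg.congr_fun fun jk ↦ thetaTerm_mul_odd x y jk.1 jk.2

/-- The theta function in additive notation, rescaled by a Gaussian factor so as to be odd. -/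
def oddTheta (p : ℝ) (u : ℂ) : ℂ := pPow p ((u - 1 / 2) ^ 2 / 2) * theta p (pPow p u)

lemma oddTheta_ne_zero {u : ℂ} (h : theta p (pPow p u) ≠ 0) : oddTheta p u ≠ 0 :=
  mul_ne_zero (pPow_ne_zero p _) h

lemma isThetaLike_oddTheta (hp0 : 0 < p) (hp1 : p < 1) : IsThetaLike (oddTheta p) := by
  obtain ⟨K, hK⟩ := exists_theta_eq_tsum hp0 hp1
  have hs (u : ℂ) : oddTheta p u = K * ∑' n : ℤ, thetaTerm p u n := hK u
  refine ⟨fun u ↦ ?_, fun a b c d ↦ ?_⟩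
  · rw [hs, hs, tsum_thetaTerm_neg, mul_neg]
  · have hmul (x y : ℂ) : oddTheta p (x + y) * oddTheta p (x - y) = K ^ 2 *
        ((∑' n : ℤ, pPow p ((n + (x - 1 / 2)) ^ 2)) * (∑' n : ℤ, pPow p ((n + y) ^ 2)) -
          (∑' n : ℤ, pPow p ((n + x) ^ 2)) * ∑' n : ℤ, pPow p ((n + (y - 1 / 2)) ^ 2)) := by
      rw [← tsum_thetaTerm_mul hp0 hp1, hs, hs]
      ring
    simp only [hmul]
    ring

end Limit

section Entries

variable {p : ℝ} {κ x : ℂ} {φ : Fin 3 → ℂ}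

lemma sgn3_eq_or (i : Fin 3) : sgn3 i = 1 ∨ sgn3 i = -1 := by
  rw [sgn3]; split_ifs <;> simp

lemma RAdm.oddTheta_ne_zero (h : RAdm p κ x φ) : oddTheta p (2 * κ - x) ≠ 0 :=
  _root_.oddTheta_ne_zero h.2.2.1

lemma RAdm.oddTheta_sub_ne_zero (h : RAdm p κ x φ) {i j : Fin 3} (hij : i ≠ j) :
    oddTheta p (φ i - φ j) ≠ 0 :=
  _root_.oddTheta_ne_zero (h.2.2.2 i j hij)

lemma Afun_eq (h : RAdm p κ x φ) {i j : Fin 3} (hij : i ≠ j) :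
    Afun p κ (φ i - φ j) x =
      (oddTheta p (2 * κ - x))⁻¹ * diagCoeff (oddTheta p) (2 * κ) (φ i - φ j) x := by
  have h1 := h.2.2.1
  have h2 := h.2.2.2 i j hij
  generalize φ i - φ j = u at *
  have hg : pPow p ((2 * κ - 1 / 2) ^ 2 / 2) * pPow p ((u - x - 1 / 2) ^ 2 / 2) =
      pPow p ((u - 1 / 2) ^ 2 / 2) * pPow p ((2 * κ - x - 1 / 2) ^ 2 / 2) *
        pPow p ((2 * κ - u) * x) := by
    simp only [← pPow_add]; ring_nf
  have h3 := pPow_ne_zero p ((u - 1 / 2) ^ 2 / 2)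
  have h4 := pPow_ne_zero p ((2 * κ - x - 1 / 2) ^ 2 / 2)
  simp only [Afun, diagCoeff, oddTheta]
  generalize pPow p ((u - 1 / 2) ^ 2 / 2) = a at *
  generalize pPow p ((2 * κ - x - 1 / 2) ^ 2 / 2) = b at *
  generalize pPow p ((2 * κ - 1 / 2) ^ 2 / 2) = c at *
  generalize pPow p ((u - x - 1 / 2) ^ 2 / 2) = d at *
  generalize pPow p ((2 * κ - u) * x) = e at *
  field_simp
  linear_combination -hg * theta p (pPow p (2 * κ)) * theta p (pPow p (u - x))

lemma Bfun_eq (hp0 : 0 < p) (hp1 : p < 1) (h : RAdm p κ x φ) {i j : Fin 3} (hij : i ≠ j) :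
    Bfun p κ (φ i - φ j) x =
      (oddTheta p (2 * κ - x))⁻¹ * swapCoeff (oddTheta p) (2 * κ) (φ i - φ j) x := by
  have h1 := h.2.2.1
  have h2 := h.2.2.2 j i hij.symm
  rw [← neg_sub] at h2
  generalize φ i - φ j = u at *
  have hg : pPow p ((2 * κ - u - 1 / 2) ^ 2 / 2) * pPow p ((-x - 1 / 2) ^ 2 / 2) =
      pPow p ((-u - 1 / 2) ^ 2 / 2) * pPow p ((2 * κ - x - 1 / 2) ^ 2 / 2) *
        pPow p (2 * κ * (x - u)) := by
    simp only [← pPow_add]; ring_nf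
  have h3 := pPow_ne_zero p ((-u - 1 / 2) ^ 2 / 2)
  have h4 := pPow_ne_zero p ((2 * κ - x - 1 / 2) ^ 2 / 2)
  have ho := (isThetaLike_oddTheta hp0 hp1).odd
  have hsw : swapCoeff (oddTheta p) (2 * κ) u x =
      oddTheta p (2 * κ - u) * oddTheta p (-x) / oddTheta p (-u) := by
    rw [swapCoeff, ho, ho, mul_neg, neg_div_neg_eq]
  rw [hsw]
  simp only [Bfun, oddTheta]
  generalize pPow p ((-u - 1 / 2) ^ 2 / 2) = a at *
  generalize pPow p ((2 * κ - x - 1 / 2) ^ 2 / 2) = b at *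
  generalize pPow p ((2 * κ - u - 1 / 2) ^ 2 / 2) = c at *
  generalize pPow p ((-x - 1 / 2) ^ 2 / 2) = d at *
  generalize pPow p (2 * κ * (x - u)) = e at *
  field_simp
  linear_combination -hg * theta p (pPow p (2 * κ - u)) * theta p (pPow p (-x))

lemma cfun_eq :
    cfun p κ x = pPow p (κ - 2 * κ ^ 2) * (oddTheta p (2 * κ + x) / oddTheta p x) := by
  have hg : pPow p (κ - 2 * κ ^ 2) * pPow p ((2 * κ + x - 1 / 2) ^ 2 / 2) =
      pPow p (2 * κ * x) * pPow p ((x - 1 / 2) ^ 2 / 2) := by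
    simp only [← pPow_add]; ring_nf
  have h0 := pPow_ne_zero p ((x - 1 / 2) ^ 2 / 2)
  rw [cfun, oddTheta, oddTheta, ← mul_div_assoc, ← mul_assoc, hg]
  generalize pPow p ((x - 1 / 2) ^ 2 / 2) = a at *
  field_simp

lemma sgn3_mul_cfun_div (hp0 : 0 < p) (hp1 : p < 1) (h : RAdm p κ x φ) (i : Fin 3) :
    sgn3 i * (cfun p κ x / cfun p κ (sgn3 i * x)) =
      (oddTheta p (2 * κ - x))⁻¹ * oddTheta p (2 * κ - sgn3 i * x) := by
  have hx := _root_.oddTheta_ne_zero h.1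
  have hp := _root_.oddTheta_ne_zero h.2.1
  have hm := h.oddTheta_ne_zero
  have hg := pPow_ne_zero p (κ - 2 * κ ^ 2)
  rw [cfun_eq, cfun_eq, mul_div_mul_left _ _ hg]
  rcases sgn3_eq_or i with hi | hi <;> rw [hi]
  · rw [one_mul, one_mul, div_self (div_ne_zero hp hx), inv_mul_cancel₀ hm]
  · rw [neg_one_mul, neg_one_mul, (isThetaLike_oddTheta hp0 hp1).odd, sub_neg_eq_add,
      ← sub_eq_add_neg, div_neg, div_neg, neg_neg, div_div_div_cancel_right₀ hx, div_eq_inv_mul]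

end Entries

section Action

open scoped Matrix

variable {p : ℝ} {κ x : ℂ} {ψ : Fin 3 → Fin 3 → ℂ}

lemma R12_mulVec_single_self (hp0 : 0 < p) (hp1 : p < 1) {i k : Fin 3} (h : RAdm p κ x (ψ k)) :
    R12 p κ x ψ *ᵥ Pi.single (i, i, k) 1 = (oddTheta p (2 * κ - x))⁻¹ •
      oddTheta p (2 * κ - sgn3 i * x) • Pi.single (i, i, k) 1 := by
  rw [Matrix.mulVec_single_one, smul_smul, ← sgn3_mul_cfun_div hp0 hp1 h]
  ext ⟨a, b, c⟩
  by_cases hc : c = k <;> simp [R12, Rop, Pi.single_apply, Matrix.col, hc]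

lemma R12_mulVec_single_of_ne (hp0 : 0 < p) (hp1 : p < 1) {i j k : Fin 3}
    (h : RAdm p κ x (ψ k)) (hij : i ≠ j) {u : ℂ} (hu : ψ k i - ψ k j = u) :
    R12 p κ x ψ *ᵥ Pi.single (i, j, k) 1 = (oddTheta p (2 * κ - x))⁻¹ •
      (diagCoeff (oddTheta p) (2 * κ) u x • Pi.single (i, j, k) 1 +
        (sgn3 i * sgn3 j * swapCoeff (oddTheta p) (2 * κ) u x) • Pi.single (j, i, k) 1) := by
  rw [Matrix.mulVec_single_one, smul_add, smul_smul, smul_smul, mul_left_comm, ← hu,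
    ← Afun_eq h hij, ← Bfun_eq hp0 hp1 h hij]
  ext ⟨a, b, c⟩
  by_cases hc : c = k <;> simp [R12, Rop, Pi.single_apply, Matrix.col, hij, hc]

lemma R23_mulVec_single_self (hp0 : 0 < p) (hp1 : p < 1) {i k : Fin 3} (h : RAdm p κ x (ψ k)) :
    R23 p κ x ψ *ᵥ Pi.single (k, i, i) 1 = (oddTheta p (2 * κ - x))⁻¹ •
      oddTheta p (2 * κ - sgn3 i * x) • Pi.single (k, i, i) 1 := by
  rw [Matrix.mulVec_single_one, smul_smul, ← sgn3_mul_cfun_div hp0 hp1 h]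
  ext ⟨a, b, c⟩
  by_cases ha : a = k <;> simp [R23, Rop, Pi.single_apply, Matrix.col, ha]

lemma R23_mulVec_single_of_ne (hp0 : 0 < p) (hp1 : p < 1) {i j k : Fin 3}
    (h : RAdm p κ x (ψ k)) (hij : i ≠ j) {u : ℂ} (hu : ψ k i - ψ k j = u) :
    R23 p κ x ψ *ᵥ Pi.single (k, i, j) 1 = (oddTheta p (2 * κ - x))⁻¹ •
      (diagCoeff (oddTheta p) (2 * κ) u x • Pi.single (k, i, j) 1 +
        (sgn3 i * sgn3 j * swapCoeff (oddTheta p) (2 * κ) u x) • Pi.single (k, j, i) 1) := by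
  rw [Matrix.mulVec_single_one, smul_add, smul_smul, smul_smul, mul_left_comm, ← hu,
    ← Afun_eq h hij, ← Bfun_eq hp0 hp1 h hij]
  ext ⟨a, b, c⟩
  by_cases ha : a = k <;> simp [R23, Rop, Pi.single_apply, Matrix.col, hij, ha]

end Action

section YangBaxter

open scoped Matrix

variable {p : ℝ} {κ x y : ℂ} {φ : Fin 3 → ℂ}

lemma sgn3_mul_self (i : Fin 3) : sgn3 i * sgn3 i = 1 := by
  rcases sgn3_eq_or i with h | h <;> simp [h]

/-- The left-hand side of the braid-like dynamical Yang–Baxter equation. -/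
def braidLeft (p : ℝ) (κ x y : ℂ) (φ : Fin 3 → ℂ) :
    Matrix (Fin 3 × Fin 3 × Fin 3) (Fin 3 × Fin 3 × Fin 3) ℂ :=
  R12 p κ x (fun k j => φ j + κ * wt3 k j) * R23 p κ (x + y) (fun k j => φ j - κ * wt3 k j) *
    R12 p κ y (fun k j => φ j + κ * wt3 k j)

/-- The right-hand side of the braid-like dynamical Yang–Baxter equation. -/
def braidRight (p : ℝ) (κ x y : ℂ) (φ : Fin 3 → ℂ) :
    Matrix (Fin 3 × Fin 3 × Fin 3) (Fin 3 × Fin 3 × Fin 3) ℂ :=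
  R23 p κ y (fun k j => φ j - κ * wt3 k j) * R12 p κ (x + y) (fun k j => φ j + κ * wt3 k j) *
    R23 p κ x (fun k j => φ j - κ * wt3 k j)

/-- Admissibility of `(x, y, φ)` for the braid-like dynamical Yang–Baxter equation. -/
def BraidAdm (p : ℝ) (κ x y : ℂ) (φ : Fin 3 → ℂ) : Prop :=
  ∀ k : Fin 3, ∀ z ∈ ({x, y, x + y} : Set ℂ),
    RAdm p κ z (fun j => φ j + κ * wt3 k j) ∧ RAdm p κ z (fun j => φ j - κ * wt3 k j)

lemma braid_mulVec_single_self (hp0 : 0 < p) (hp1 : p < 1) (h : BraidAdm p κ x y φ)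
    (i : Fin 3) :
    braidLeft p κ x y φ *ᵥ Pi.single (i, i, i) 1 =
      braidRight p κ x y φ *ᵥ Pi.single (i, i, i) 1 := by
  have h12 (z) (hz : z ∈ ({x, y, x + y} : Set ℂ)) :=
    R12_mulVec_single_self (ψ := fun k j => φ j + κ * wt3 k j) hp0 hp1 (i := i) (h i z hz).1
  have h23 (z) (hz : z ∈ ({x, y, x + y} : Set ℂ)) :=
    R23_mulVec_single_self (ψ := fun k j => φ j - κ * wt3 k j) hp0 hp1 (i := i) (h i z hz).2
  simp only [braidLeft, braidRight, ← Matrix.mulVec_mulVec, Matrix.mulVec_smul, h12, h23,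
    Set.mem_insert_iff, Set.mem_singleton_iff, true_or, or_true]
  module

lemma braid_mulVec_single_distinct (hp0 : 0 < p) (hp1 : p < 1) (h : BraidAdm p κ x y φ)
    {i j k : Fin 3} (hij : i ≠ j) (hjk : j ≠ k) (hik : i ≠ k) :
    braidLeft p κ x y φ *ᵥ Pi.single (i, j, k) 1 =
      braidRight p κ x y φ *ᵥ Pi.single (i, j, k) 1 := by
  have hs := isThetaLike_oddTheta hp0 hp1
  have hshift {a b c : Fin 3} (hac : a ≠ c) (hbc : b ≠ c) :
      φ a + κ * wt3 c a - (φ b + κ * wt3 c b) = φ a - φ b ∧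
        φ a - κ * wt3 c a - (φ b - κ * wt3 c b) = φ a - φ b := by
    simp [wt3, hac, hbc]
  have h0 {a b c : Fin 3} (hab : a ≠ b) (hac : a ≠ c) (hbc : b ≠ c) :
      oddTheta p (φ a - φ b) ≠ 0 := by
    have := (h c x (by simp)).1.oddTheta_sub_ne_zero hab
    rwa [(hshift hac hbc).1] at this
  have h12 {a b c : Fin 3} (hab : a ≠ b) (hac : a ≠ c) (hbc : b ≠ c) (z)
      (hz : z ∈ ({x, y, x + y} : Set ℂ)) :=
    R12_mulVec_single_of_ne (ψ := fun k j => φ j + κ * wt3 k j) hp0 hp1 (h c z hz).1 hab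
      (hshift hac hbc).1
  have h23 {a b c : Fin 3} (hab : a ≠ b) (hac : a ≠ c) (hbc : b ≠ c) (z)
      (hz : z ∈ ({x, y, x + y} : Set ℂ)) :=
    R23_mulVec_single_of_ne (ψ := fun k j => φ j - κ * wt3 k j) hp0 hp1 (h c z hz).2 hab
      (hshift hac hbc).2
  simp only [braidLeft, braidRight, ← Matrix.mulVec_mulVec, Matrix.mulVec_smul,
    Matrix.mulVec_add, h12, h23, Set.mem_insert_iff, Set.mem_singleton_iff, true_or, or_true,
    hij, hjk, hik, hij.symm, hjk.symm, hik.symm, ne_eq, not_false_eq_true]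
  have hu := h0 hij hik hjk
  have hv := h0 hjk hij.symm hik.symm
  have huv := h0 hik hij hjk.symm
  obtain ⟨u, hu'⟩ : ∃ u, φ i - φ j = u := ⟨_, rfl⟩
  obtain ⟨v, hv'⟩ : ∃ v, φ j - φ k = v := ⟨_, rfl⟩
  have huv' : φ i - φ k = u + v := by rw [← hu', ← hv']; ring
  rw [hu'] at hu
  rw [hv'] at hv
  rw [huv'] at huv
  rw [hu', hv', huv', ← neg_sub (φ i) (φ j), ← neg_sub (φ j) (φ k), hu', hv']
  have e1 := hs.yb_distinct_id hu hv huv (2 * κ) x y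
  have e2 := hs.yb_distinct_swap hu hv huv (2 * κ) x y
  have e3 := hs.yb_distinct_swap hv hu (by rwa [add_comm]) (2 * κ) y x
  rw [add_comm v u, add_comm y x] at e3
  have e4 := swapCoeff_mul_comm (oddTheta p) (2 * κ)
  have hi := sgn3_mul_self i
  have hj := sgn3_mul_self j
  have hk := sgn3_mul_self k
  have si : sgn3 i * sgn3 j * (sgn3 j * sgn3 i) = 1 := by
    linear_combination sgn3 i * sgn3 i * hj + hi
  have sk : sgn3 j * sgn3 k * (sgn3 k * sgn3 j) = 1 := by
    linear_combination sgn3 k * sgn3 k * hj + hk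
  set D := diagCoeff (oddTheta p) (2 * κ)
  set S := swapCoeff (oddTheta p) (2 * κ)
  generalize (oddTheta p (2 * κ - x))⁻¹ = a
  generalize (oddTheta p (2 * κ - y))⁻¹ = b
  generalize (oddTheta p (2 * κ - (x + y)))⁻¹ = c
  match_scalars
  · linear_combination a * b * c * (e1 + S u y * D (u + v) (x + y) * S (-u) x * si -
      S v x * D (u + v) (x + y) * S (-v) y * sk)
  · linear_combination a * b * c * (sgn3 i * sgn3 j) * e2
  · linear_combination a * b * c * sgn3 j * sgn3 k * -e3
  · linear_combination a * b * c * D u y * (sgn3 j * sgn3 k * (sgn3 i * sgn3 k)) *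
      e4 v (u + v) (x + y) x
  · linear_combination a * b * c * D v x * (sgn3 i * sgn3 j * (sgn3 i * sgn3 k)) *
      e4 u (u + v) y (x + y)
  · ring

lemma braid_mulVec_single_pair (hp0 : 0 < p) (hp1 : p < 1) (h : BraidAdm p κ x y φ)
    {i j : Fin 3} (hij : i ≠ j) :
    braidLeft p κ x y φ *ᵥ Pi.single (i, i, j) 1 =
        braidRight p κ x y φ *ᵥ Pi.single (i, i, j) 1 ∧
      braidLeft p κ x y φ *ᵥ Pi.single (i, j, i) 1 =
        braidRight p κ x y φ *ᵥ Pi.single (i, j, i) 1 ∧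
      braidLeft p κ x y φ *ᵥ Pi.single (j, i, i) 1 =
        braidRight p κ x y φ *ᵥ Pi.single (j, i, i) 1 := by
  have hs := isThetaLike_oddTheta hp0 hp1
  obtain ⟨u, hu⟩ : ∃ u, φ i + κ * wt3 i i - (φ j + κ * wt3 i j) = u := ⟨_, rfl⟩
  obtain ⟨v, hv⟩ : ∃ v, φ i - κ * wt3 i i - (φ j - κ * wt3 i j) = v := ⟨_, rfl⟩
  have huv : u = v + sgn3 i * (2 * κ) := by
    rw [← hu, ← hv]
    simp only [wt3, hij.symm, if_true, if_false]
    ring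
  have hu0 : oddTheta p u ≠ 0 := hu ▸ (h i x (by simp)).1.oddTheta_sub_ne_zero hij
  have hv0 : oddTheta p v ≠ 0 := hv ▸ (h i x (by simp)).2.oddTheta_sub_ne_zero hij
  have h12 (z) (hz : z ∈ ({x, y, x + y} : Set ℂ)) :=
    R12_mulVec_single_of_ne (ψ := fun k j => φ j + κ * wt3 k j) hp0 hp1 (h i z hz).1 hij hu
  have h12' (z) (hz : z ∈ ({x, y, x + y} : Set ℂ)) :=
    R12_mulVec_single_of_ne (ψ := fun k j => φ j + κ * wt3 k j) hp0 hp1 (h i z hz).1 hij.symm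
      ((neg_sub _ _).symm.trans (congrArg _ hu))
  have h12s (z) (hz : z ∈ ({x, y, x + y} : Set ℂ)) :=
    R12_mulVec_single_self (ψ := fun k j => φ j + κ * wt3 k j) hp0 hp1 (i := i) (h j z hz).1
  have h23 (z) (hz : z ∈ ({x, y, x + y} : Set ℂ)) :=
    R23_mulVec_single_of_ne (ψ := fun k j => φ j - κ * wt3 k j) hp0 hp1 (h i z hz).2 hij hv
  have h23' (z) (hz : z ∈ ({x, y, x + y} : Set ℂ)) :=
    R23_mulVec_single_of_ne (ψ := fun k j => φ j - κ * wt3 k j) hp0 hp1 (h i z hz).2 hij.symm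
      ((neg_sub _ _).symm.trans (congrArg _ hv))
  have h23s (z) (hz : z ∈ ({x, y, x + y} : Set ℂ)) :=
    R23_mulVec_single_self (ψ := fun k j => φ j - κ * wt3 k j) hp0 hp1 (i := i) (h j z hz).2
  have he := sgn3_eq_or i
  have huv' : -v = -u + sgn3 i * (2 * κ) := by rw [huv]; ring
  have hu0' : oddTheta p (-u) ≠ 0 := by rwa [hs.odd, neg_ne_zero]
  have hv0' : oddTheta p (-v) ≠ 0 := by rwa [hs.odd, neg_ne_zero]
  have e1 := hs.yb_equal_id he huv hu0 hv0 x y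
  have e2 := hs.yb_equal_swap_right he huv hu0 hv0 x y
  have e3 := hs.yb_equal_swap_left he huv hu0 hv0 x y
  have e4 := hs.yb_equal_mid he huv hu0 hv0 x y
  have e1' := hs.yb_equal_id he huv' hv0' hu0' y x
  have e2' := hs.yb_equal_swap_right he huv' hv0' hu0' y x
  have e3' := hs.yb_equal_swap_left he huv' hv0' hu0' y x
  rw [add_comm y x] at e1' e2' e3'
  simp only [neg_neg] at e1' e2' e3'
  have e5 := swapCoeff_mul_comm (oddTheta p) (2 * κ)
  have hii := sgn3_mul_self i
  have hjj := sgn3_mul_self j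
  have hs1 : sgn3 i * sgn3 j * (sgn3 j * sgn3 i) = 1 := by
    linear_combination sgn3 i * sgn3 i * hjj + hii
  simp only [braidLeft, braidRight, ← Matrix.mulVec_mulVec, Matrix.mulVec_smul,
    Matrix.mulVec_add, h12, h12', h12s, h23, h23', h23s, Set.mem_insert_iff,
    Set.mem_singleton_iff, true_or, or_true]
  set D := diagCoeff (oddTheta p) (2 * κ)
  set S := swapCoeff (oddTheta p) (2 * κ)
  generalize oddTheta p (2 * κ - sgn3 i * x) = dx at *
  generalize oddTheta p (2 * κ - sgn3 i * y) = dy at *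
  generalize oddTheta p (2 * κ - sgn3 i * (x + y)) = dz at *
  generalize (oddTheta p (2 * κ - x))⁻¹ = a
  generalize (oddTheta p (2 * κ - y))⁻¹ = b
  generalize (oddTheta p (2 * κ - (x + y)))⁻¹ = c
  refine ⟨?_, ?_, ?_⟩ <;> match_scalars
  · linear_combination a * b * c * (e1 - S v x * D u (x + y) * S (-v) y * hs1)
  · linear_combination a * b * c * (sgn3 i * sgn3 j) * e2
  · linear_combination a * b * c * dy * (sgn3 i * sgn3 j) ^ 2 * e5 v u (x + y) x
  · linear_combination a * b * c * (e4 + S u y * dz * S (-u) x * hs1 - S (-v) x * dz * S v y * hs1)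
  · linear_combination a * b * c * (sgn3 i * sgn3 j) * -e3'
  · linear_combination a * b * c * (sgn3 i * sgn3 j) * e3
  · linear_combination a * b * c * (-e1' + S (-u) y * D (-v) (x + y) * S u x * hs1)
  · linear_combination a * b * c * (sgn3 i * sgn3 j) * -e2'
  · linear_combination a * b * c * dx * (sgn3 i * sgn3 j) ^ 2 * e5 (-u) (-v) y (x + y)

end YangBaxter

/-- **The dynamical quantum Yang–Baxter equation in braid-like form** for the elliptic
dynamical `R`-matrix attached to `gl(2|1)`: for all admissible `x, y ∈ ℂ` and `φ ∈ ℂ³`,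
`R₁₂(x;φ+κh₃) R₂₃(x+y;φ−κh₁) R₁₂(y;φ+κh₃) = R₂₃(y;φ−κh₁) R₁₂(x+y;φ+κh₃) R₂₃(x;φ−κh₁)`
as linear operators on `V ⊗ V ⊗ V`. -/
theorem dynamical_qYB_braid_form (p : ℝ) (hp0 : 0 < p) (hp1 : p < 1) (κ : ℂ)
    (x y : ℂ) (φ : Fin 3 → ℂ)
    (hadm : ∀ k : Fin 3, ∀ z ∈ ({x, y, x + y} : Set ℂ),
      RAdm p κ z (fun j => φ j + κ * wt3 k j) ∧
        RAdm p κ z (fun j => φ j - κ * wt3 k j)) :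
    R12 p κ x (fun k j => φ j + κ * wt3 k j) *
        R23 p κ (x + y) (fun k j => φ j - κ * wt3 k j) *
        R12 p κ y (fun k j => φ j + κ * wt3 k j) =
      R23 p κ y (fun k j => φ j - κ * wt3 k j) *
        R12 p κ (x + y) (fun k j => φ j + κ * wt3 k j) *
        R23 p κ x (fun k j => φ j - κ * wt3 k j) := by
  refine Matrix.ext_of_mulVec_single fun ⟨i, j, k⟩ ↦ ?_
  change (braidLeft p κ x y φ).mulVec _ = (braidRight p κ x y φ).mulVec _
  by_cases hij : i = j
  · subst hij
    by_cases hik : i = k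
    · subst hik
      exact braid_mulVec_single_self hp0 hp1 hadm i
    · exact (braid_mulVec_single_pair hp0 hp1 hadm hik).1
  by_cases hik : i = k
  · subst hik
    exact (braid_mulVec_single_pair hp0 hp1 hadm hij).2.1
  by_cases hjk : j = k
  · subst hjk
    exact (braid_mulVec_single_pair hp0 hp1 hadm (Ne.symm hij)).2.2
  exact braid_mulVec_single_distinct hp0 hp1 hadm hij hjk hik

end
end

section
/- Baxterization: the operator R(z) := P ∘ (B⁻¹ − zB)/(q⁻¹ − qz) is a unitary solution of the quantum Yang–Baxter equation with spectral parameter. Precisely: (i) for all x, y ∈ ℂ with x ≠ q⁻², y ≠ q⁻², xy ≠ q⁻², one has R₁₂(x) R₁₃(xy) R₂₃(y) = R₂₃(y) R₁₃(xy) R₁₂(x) as operators on W^{⊗3}; (ii) for all z ∈ ℂ with z ≠ 0, z ≠ q⁻², z⁻¹ ≠ q⁻², one has (P ∘ R(z) ∘ P) ∘ R(z⁻¹) = Id on W ⊗ W (equivalently Ř(z) ∘ Ř(z⁻¹) = Id, where Ř(z) := (B⁻¹ − zB)/(q⁻¹ − qz)). -/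
noncomputable section

open TensorProduct

variable {W : Type*} [AddCommGroup W] [Module ℂ W]

/-- For `G ∈ End(W ⊗ W)`, the operator `G₁₂ = G ⊗ Id` on `W ⊗ (W ⊗ W)`. -/
def act12 (G : W ⊗[ℂ] W →ₗ[ℂ] W ⊗[ℂ] W) :
    W ⊗[ℂ] (W ⊗[ℂ] W) →ₗ[ℂ] W ⊗[ℂ] (W ⊗[ℂ] W) :=
  (TensorProduct.assoc ℂ W W W).toLinearMap ∘ₗ
    TensorProduct.map G LinearMap.id ∘ₗ (TensorProduct.assoc ℂ W W W).symm.toLinearMap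

/-- For `G ∈ End(W ⊗ W)`, the operator `G₂₃ = Id ⊗ G` on `W ⊗ (W ⊗ W)`. -/
def act23 (G : W ⊗[ℂ] W →ₗ[ℂ] W ⊗[ℂ] W) :
    W ⊗[ℂ] (W ⊗[ℂ] W) →ₗ[ℂ] W ⊗[ℂ] (W ⊗[ℂ] W) :=
  TensorProduct.map LinearMap.id G

/-- The flip of the last two tensor legs of `W ⊗ (W ⊗ W)`. -/
def flip23 : W ⊗[ℂ] (W ⊗[ℂ] W) →ₗ[ℂ] W ⊗[ℂ] (W ⊗[ℂ] W) :=
  TensorProduct.map LinearMap.id (TensorProduct.comm ℂ W W).toLinearMap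

/-- For `G ∈ End(W ⊗ W)`, the operator `G₁₃` acting in the first and third tensor legs
of `W ⊗ (W ⊗ W)`. -/
def act13 (G : W ⊗[ℂ] W →ₗ[ℂ] W ⊗[ℂ] W) :
    W ⊗[ℂ] (W ⊗[ℂ] W) →ₗ[ℂ] W ⊗[ℂ] (W ⊗[ℂ] W) :=
  flip23 ∘ₗ act12 G ∘ₗ flip23

/-- The permutation (flip) operator `P : W ⊗ W → W ⊗ W`, `u ⊗ v ↦ v ⊗ u`. -/
def flipW : W ⊗[ℂ] W →ₗ[ℂ] W ⊗[ℂ] W := (TensorProduct.comm ℂ W W).toLinearMap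

/-- The Baxterization `Ř(z) := (B⁻¹ − zB)/(q⁻¹ − qz)` of a Hecke braid operator `B`,
where `B⁻¹ = B − (q − q⁻¹)·Id`. -/
def RcheckBax (q : ℂ) (B : W ⊗[ℂ] W →ₗ[ℂ] W ⊗[ℂ] W) (z : ℂ) :
    W ⊗[ℂ] W →ₗ[ℂ] W ⊗[ℂ] W :=
  (q⁻¹ - q * z)⁻¹ • ((B - (q - q⁻¹) • LinearMap.id) - z • B)

/-- The Baxterized `R`-matrix `R(z) := P ∘ Ř(z)`. -/
def RBax (q : ℂ) (B : W ⊗[ℂ] W →ₗ[ℂ] W ⊗[ℂ] W) (z : ℂ) :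
    W ⊗[ℂ] W →ₗ[ℂ] W ⊗[ℂ] W :=
  flipW ∘ₗ RcheckBax q B z

section LegOperators

variable (G H : W ⊗[ℂ] W →ₗ[ℂ] W ⊗[ℂ] W) (c : ℂ)

lemma act12_comp : act12 (G ∘ₗ H) = act12 G * act12 H := by
  ext u v w
  simp [act12]

lemma act23_comp : act23 (G ∘ₗ H) = act23 G * act23 H := by
  ext u v w
  simp [act23]

lemma act12_sub : act12 (G - H) = act12 G - act12 H := by
  ext u v w
  simp [act12, sub_tmul]

lemma act23_sub : act23 (G - H) = act23 G - act23 H := by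
  ext u v w
  simp [act23, tmul_sub]

lemma act12_smul : act12 (c • G) = c • act12 G := by
  ext u v w
  simp [act12, ← smul_tmul']

lemma act23_smul : act23 (c • G) = c • act23 G := by
  ext u v w
  simp [act23]

lemma act12_id : act12 (LinearMap.id : W ⊗[ℂ] W →ₗ[ℂ] W ⊗[ℂ] W) = 1 := by
  ext u v w
  simp [act12]

lemma act23_id : act23 (LinearMap.id : W ⊗[ℂ] W →ₗ[ℂ] W ⊗[ℂ] W) = 1 := by
  ext u v w
  simp [act23]

lemma flipW_comp_flipW :
    (flipW : W ⊗[ℂ] W →ₗ[ℂ] W ⊗[ℂ] W) ∘ₗ flipW = LinearMap.id := by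
  ext u v
  simp [flipW]

lemma act23_flipW : act23 (flipW : W ⊗[ℂ] W →ₗ[ℂ] W ⊗[ℂ] W) = flip23 := rfl

lemma flip23_mul_flip23 : (flip23 * flip23 : Module.End ℂ (W ⊗[ℂ] (W ⊗[ℂ] W))) = 1 := by
  rw [← act23_flipW, ← act23_comp, flipW_comp_flipW, act23_id]

lemma act12_flipW_mul_self :
    (act12 flipW * act12 flipW : Module.End ℂ (W ⊗[ℂ] (W ⊗[ℂ] W))) = 1 := by
  rw [← act12_comp, flipW_comp_flipW, act12_id]

/-- The transpositions of adjacent tensor legs satisfy the braid relation. -/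
lemma flip23_act12_flipW_braid :
    (flip23 * act12 flipW * flip23 : Module.End ℂ (W ⊗[ℂ] (W ⊗[ℂ] W))) =
      act12 flipW * flip23 * act12 flipW := by
  ext u v w
  simp [act12, flip23, flipW]

lemma flip23_act12_flipW_tmul (u : W) (t : W ⊗[ℂ] W) :
    flip23 (act12 flipW (u ⊗ₜ[ℂ] t)) = TensorProduct.assoc ℂ W W W (t ⊗ₜ[ℂ] u) := by
  induction t with
  | zero => simp
  | tmul v w => simp [act12, flip23, flipW]
  | add s t hs ht => simp only [tmul_add, add_tmul, map_add, hs, ht]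

/-- The cyclic permutation of the tensor legs intertwines `G₂₃` and `G₁₂`. -/
lemma act12_mul_cycle :
    act12 G * (flip23 * act12 flipW) = flip23 * act12 flipW * act23 G := by
  ext u v w
  simp only [AlgebraTensorModule.curry_apply, LinearMap.restrictScalars_self, curry_apply,
    Module.End.mul_apply, flip23_act12_flipW_tmul, act23, map_tmul, LinearMap.id_apply]
  simp [act12]

/-- The inverse cyclic permutation of the tensor legs intertwines `G₁₂` and `G₂₃`. -/
lemma act23_mul_cycle_symm :
    act23 G * (act12 flipW * flip23) = act12 flipW * flip23 * act12 G := by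
  have hP := act12_flipW_mul_self (W := W)
  have hF := flip23_mul_flip23 (W := W)
  have hl : act12 flipW * flip23 * (flip23 * act12 flipW) =
      (1 : Module.End ℂ (W ⊗[ℂ] (W ⊗[ℂ] W))) := by
    rw [mul_assoc, ← mul_assoc flip23, hF, one_mul, hP]
  have hr : flip23 * act12 flipW * (act12 flipW * flip23) =
      (1 : Module.End ℂ (W ⊗[ℂ] (W ⊗[ℂ] W))) := by
    rw [mul_assoc, ← mul_assoc (act12 flipW), hP, one_mul, hF]
  calc act23 G * (act12 flipW * flip23)
      = act12 flipW * flip23 * (flip23 * act12 flipW) * act23 G *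
          (act12 flipW * flip23) := by rw [hl, one_mul]
    _ = act12 flipW * flip23 * (flip23 * act12 flipW * act23 G) *
          (act12 flipW * flip23) := by simp only [mul_assoc]
    _ = act12 flipW * flip23 * act12 G *
          (flip23 * act12 flipW * (act12 flipW * flip23)) := by
        rw [← act12_mul_cycle]; simp only [mul_assoc]
    _ = act12 flipW * flip23 * act12 G := by rw [hr, mul_one]

end LegOperators

/-- The braid form of the Yang–Baxter equation for `Ř = flipW ∘ R` implies the
Yang–Baxter equation for `R`. -/
lemma yang_baxter_of_braid (G H K : W ⊗[ℂ] W →ₗ[ℂ] W ⊗[ℂ] W)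
    (h : act23 G * act12 H * act23 K = act12 K * act23 H * act12 G) :
    act12 (flipW ∘ₗ G) * act13 (flipW ∘ₗ H) * act23 (flipW ∘ₗ K) =
      act23 (flipW ∘ₗ K) * act13 (flipW ∘ₗ H) * act12 (flipW ∘ₗ G) := by
  have h13 : act13 (flipW ∘ₗ H) = flip23 * (act12 flipW * act12 H) * flip23 := by
    rw [← act12_comp]; rfl
  have hF := flip23_mul_flip23 (W := W)
  have hbraid := flip23_act12_flipW_braid (W := W)
  rw [h13, act12_comp, act23_comp, act23_flipW]
  calc act12 flipW * act12 G * (flip23 * (act12 flipW * act12 H) * flip23) *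
        (flip23 * act23 K)
      = act12 flipW * (act12 G * (flip23 * act12 flipW)) * act12 H *
          (flip23 * flip23) * act23 K := by simp only [mul_assoc]
    _ = act12 flipW * flip23 * act12 flipW * (act23 G * act12 H * act23 K) := by
        rw [hF, act12_mul_cycle]; simp only [mul_assoc, one_mul]
    _ = flip23 * (act12 flipW * flip23 * act12 K) * act23 H * act12 G := by
        rw [h, ← hbraid]; simp only [mul_assoc]
    _ = flip23 * act23 K * (act12 flipW * flip23 * act23 H) * act12 G := by
        rw [← act23_mul_cycle_symm]; simp only [mul_assoc]
    _ = flip23 * act23 K * (flip23 * (flip23 * act12 flipW * flip23)) * act23 H *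
          act12 G := by
        simp only [← mul_assoc, hF]
        simp only [mul_assoc, one_mul]
    _ = flip23 * act23 K * flip23 * act12 flipW * (flip23 * act12 flipW * act23 H) *
          act12 G := by
        rw [hbraid]; simp only [mul_assoc]
    _ = flip23 * act23 K * (flip23 * (act12 flipW * act12 H) * flip23) *
          (act12 flipW * act12 G) := by
        rw [← act12_mul_cycle]; simp only [mul_assoc]

/-- Baxterization in the Hecke algebra: with `a² = c a + 1`, `b² = c b + 1` and `aba = bab`, the
elements `a - c - x a` and `b - c - x b` satisfy the braid relation with spectral parameter. -/
lemma hecke_baxterization {A : Type*} [Ring A] [Algebra ℂ A] {a b : A} {c : ℂ}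
    (ha : a * a = c • a + 1) (hb : b * b = c • b + 1) (hab : a * b * a = b * a * b) (x y : ℂ) :
    (b - c • 1 - x • b) * (a - c • 1 - (x * y) • a) * (b - c • 1 - y • b) =
      (a - c • 1 - y • a) * (b - c • 1 - (x * y) • b) * (a - c • 1 - x • a) := by
  simp only [mul_sub, sub_mul, smul_mul_assoc, mul_smul_comm, mul_one, one_mul, hab, ha, hb,
    smul_sub]
  module

theorem RcheckBax_mul_RcheckBax_inv {q : ℂ} (hq : q ≠ 0) {B : W ⊗[ℂ] W →ₗ[ℂ] W ⊗[ℂ] W}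
    (hB : B * B = (q - q⁻¹) • B + 1) {z : ℂ} (hz : z ≠ 0) (h₁ : q⁻¹ - q * z ≠ 0)
    (h₂ : q⁻¹ - q * z⁻¹ ≠ 0) :
    RcheckBax q B z * RcheckBax q B z⁻¹ = 1 := by
  have key : (B - (q - q⁻¹) • 1 - z • B) * (B - (q - q⁻¹) • 1 - z⁻¹ • B) =
      ((q⁻¹ - q * z) * (q⁻¹ - q * z⁻¹)) • (1 : Module.End ℂ (W ⊗[ℂ] W)) := by
    simp only [mul_sub, sub_mul, smul_mul_assoc, mul_smul_comm, mul_one, one_mul, hB, smul_sub]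
    match_scalars <;> field_simp <;> ring
  change ((q⁻¹ - q * z)⁻¹ • (B - (q - q⁻¹) • 1 - z • B)) *
    ((q⁻¹ - q * z⁻¹)⁻¹ • (B - (q - q⁻¹) • 1 - z⁻¹ • B)) = 1
  rw [smul_mul_smul_comm, key, smul_smul, ← mul_inv, inv_mul_cancel₀ (mul_ne_zero h₁ h₂),
    one_smul]

/-- **Baxterization.** Let `B ∈ End(W ⊗ W)` satisfy the braid relation and the Hecke relation
`(B − q)(B + q⁻¹) = 0`. Then `R(z) := P ∘ (B⁻¹ − zB)/(q⁻¹ − qz)` is a unitary solution of the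
quantum Yang–Baxter equation with spectral parameter:
(i) `R₁₂(x) R₁₃(xy) R₂₃(y) = R₂₃(y) R₁₃(xy) R₁₂(x)` on `W^{⊗3}` for `x, y, xy ≠ q⁻²`;
(ii) `(P ∘ R(z) ∘ P) ∘ R(z⁻¹) = Id` on `W ⊗ W` for `z ≠ 0`, `z ≠ q⁻²`, `z⁻¹ ≠ q⁻²`. -/
theorem baxterization_yang_baxter
    [FiniteDimensional ℂ W] (q : ℂ) (hq : q ≠ 0)
    (B : W ⊗[ℂ] W →ₗ[ℂ] W ⊗[ℂ] W)
    (hbraid : act12 B ∘ₗ act23 B ∘ₗ act12 B = act23 B ∘ₗ act12 B ∘ₗ act23 B)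
    (hhecke : (B - q • LinearMap.id) ∘ₗ (B + q⁻¹ • LinearMap.id) = 0) :
    (∀ x y : ℂ, x ≠ (q ^ 2)⁻¹ → y ≠ (q ^ 2)⁻¹ → x * y ≠ (q ^ 2)⁻¹ →
      act12 (RBax q B x) ∘ₗ act13 (RBax q B (x * y)) ∘ₗ act23 (RBax q B y) =
        act23 (RBax q B y) ∘ₗ act13 (RBax q B (x * y)) ∘ₗ act12 (RBax q B x)) ∧
    (∀ z : ℂ, z ≠ 0 → z ≠ (q ^ 2)⁻¹ → z⁻¹ ≠ (q ^ 2)⁻¹ →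
      (flipW ∘ₗ RBax q B z ∘ₗ flipW) ∘ₗ RBax q B z⁻¹ = LinearMap.id) := by
  have hB : B * B = (q - q⁻¹) • B + 1 := by
    have h : (B - q • 1) * (B + q⁻¹ • 1) = 0 := hhecke
    simp only [sub_mul, mul_add, smul_mul_assoc, mul_smul_comm, mul_one, one_mul] at h
    rw [← sub_eq_zero, ← h]
    match_scalars <;> field_simp
    ring
  refine ⟨fun x y _ _ _ => ?_, fun z hz hz₁ hz₂ => ?_⟩
  · refine yang_baxter_of_braid _ _ _ ?_
    have ha : act12 B * act12 B = (q - q⁻¹) • act12 B + 1 := by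
      rw [← act12_comp, ← act12_id, ← act12_smul, ← sub_eq_iff_eq_add', ← act12_sub]
      exact congrArg act12 (sub_eq_iff_eq_add'.mpr hB)
    have hb : act23 B * act23 B = (q - q⁻¹) • act23 B + 1 := by
      rw [← act23_comp, ← act23_id, ← act23_smul, ← sub_eq_iff_eq_add', ← act23_sub]
      exact congrArg act23 (sub_eq_iff_eq_add'.mpr hB)
    simp only [RcheckBax, act12_smul, act23_smul, act12_sub, act23_sub, act12_id, act23_id,
      smul_mul_smul_comm]
    rw [hecke_baxterization ha hb hbraid]
    congr 1
    ring
  · have hden : ∀ w : ℂ, w ≠ (q ^ 2)⁻¹ → q⁻¹ - q * w ≠ 0 := by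
      intro w hw h
      apply hw
      field_simp at h ⊢
      linear_combination -h
    have hR := RcheckBax_mul_RcheckBax_inv hq hB hz (hden z hz₁) (hden z⁻¹ hz₂)
    have hP : (flipW * flipW : Module.End ℂ (W ⊗[ℂ] W)) = 1 := flipW_comp_flipW
    change flipW * (flipW * RcheckBax q B z * flipW) * (flipW * RcheckBax q B z⁻¹) = 1
    simp only [mul_assoc, ← mul_assoc flipW flipW, hP, one_mul, hR]

end
end
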